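/- arXiv:math/0611092 — 2 statements merged into one kernel-verified Lean document; each statement's English description precedes it below -/
import Mathlib

section
/- Let n, k ≥ 1 and let A₁, …, A_k be real n×n matrices. Then every convex combination Σ_{i=1}^k p_i A_i with p ∈ S_k is invertible if and only if every convex combination Σ_{i=1}^k p_i B(A_i) with p ∈ S_k is Hurwitz stable. -/
open Matrix

/-- The block matrix `B(A) = [[0, Aᵀ], [-A, -I]]`. -/
def Bmat {n : ℕ} (A : Matrix (Fin n) (Fin n) ℝ) :
    Matrix (Fin n ⊕ Fin n) (Fin n ⊕ Fin n) ℝ :=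
  Matrix.fromBlocks 0 Aᵀ (-A) (-1)

/-- A real square matrix is Hurwitz stable if every eigenvalue (over `ℂ`)
has negative real part. -/
def IsHurwitz {m : Type*} [Fintype m] [DecidableEq m] (C : Matrix m m ℝ) : Prop :=
  ∀ lam ∈ spectrum ℂ (C.map Complex.ofReal), lam.re < 0

theorem Matrix.mem_spectrum_iff_exists_mulVec_eq_smul {K m : Type*} [Field K] [Fintype m]
    [DecidableEq m] (M : Matrix m m K) (c : K) :
    c ∈ spectrum K M ↔ ∃ v ≠ 0, M *ᵥ v = c • v := by
  rw [spectrum.mem_iff, Matrix.isUnit_iff_isUnit_det, isUnit_iff_ne_zero, not_not,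
    ← Matrix.exists_mulVec_eq_zero_iff]
  refine exists_congr fun v => and_congr_right fun _ => ?_
  rw [Matrix.sub_mulVec, sub_eq_zero, Matrix.algebraMap_eq_diagonal]
  simp [← Matrix.smul_one_eq_diagonal, Matrix.smul_mulVec, eq_comm, Pi.algebraMap_def]

theorem Bmat_map {n : ℕ} (A : Matrix (Fin n) (Fin n) ℝ) :
    (Bmat A).map Complex.ofReal =
      fromBlocks 0 (A.map Complex.ofReal)ᵀ (-A.map Complex.ofReal) (-1) := by
  ext (i | i) (j | j) <;> simp [Bmat, Matrix.one_apply, apply_ite Complex.ofReal]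

theorem sum_smul_Bmat {n k : ℕ} (A : Fin k → Matrix (Fin n) (Fin n) ℝ) {p : Fin k → ℝ}
    (hp : ∑ i, p i = 1) : ∑ i, p i • Bmat (A i) = Bmat (∑ i, p i • A i) := by
  ext (i | i) (j | j) <;> simp [Bmat, Matrix.sum_apply, ← Finset.sum_mul, hp]

theorem isUnit_map_ofReal {n : ℕ} (A : Matrix (Fin n) (Fin n) ℝ) :
    IsUnit (A.map Complex.ofReal) ↔ IsUnit A := by
  rw [Matrix.isUnit_iff_isUnit_det, Matrix.isUnit_iff_isUnit_det, isUnit_iff_ne_zero,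
    isUnit_iff_ne_zero]
  have h : (A.map Complex.ofReal).det = (A.det : ℂ) := (Complex.ofRealHom.map_det A).symm
  rw [h, Complex.ofReal_ne_zero]

open scoped ComplexOrder in
theorem star_dotProduct_self_re_nonneg {m : Type*} [Fintype m] (x : m → ℂ) :
    0 ≤ (star x ⬝ᵥ x).re :=
  (Complex.le_def.1 (dotProduct_star_self_nonneg x)).1

open scoped ComplexOrder in
theorem star_dotProduct_self_im {m : Type*} [Fintype m] (x : m → ℂ) :
    (star x ⬝ᵥ x).im = 0 :=
  (Complex.le_def.1 (dotProduct_star_self_nonneg x)).2.symm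

/-- The real part of an eigenvalue of `B(A)`, via the energy identity
`Re c * (‖x‖² + ‖y‖²) = -‖y‖²` for an eigenvector `(x, y)`. -/
theorem re_mul_eq_neg_of_eigenvector {n : ℕ} (A : Matrix (Fin n) (Fin n) ℝ) {c : ℂ}
    {x y : Fin n → ℂ} (hx : (A.map Complex.ofReal)ᵀ *ᵥ y = c • x)
    (hy : -(A.map Complex.ofReal *ᵥ x) - y = c • y) :
    c.re * ((star x ⬝ᵥ x).re + (star y ⬝ᵥ y).re) = -(star y ⬝ᵥ y).re := by
  set M := A.map Complex.ofReal with hM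
  have hMH : Mᴴ = Mᵀ := by ext i j; simp [hM]
  have hadj : star y ⬝ᵥ M *ᵥ x = star (star x ⬝ᵥ Mᵀ *ᵥ y) := by
    rw [star_dotProduct, star_mulVec, ← hMH, dotProduct_mulVec]
  have h₁ := congrArg Complex.re (congrArg (star x ⬝ᵥ ·) hx)
  have h₂ := congrArg Complex.re (congrArg (star y ⬝ᵥ ·) hy)
  have h₃ := congrArg Complex.re hadj
  simp only [dotProduct_sub, dotProduct_neg, dotProduct_smul, smul_eq_mul, Complex.mul_re,
    Complex.sub_re, Complex.neg_re, star_dotProduct_self_im, mul_zero, sub_zero] at h₁ h₂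
  simp only [Complex.star_def, Complex.conj_re] at h₃
  linarith

open scoped ComplexOrder in
theorem isHurwitz_Bmat_iff {n : ℕ} (A : Matrix (Fin n) (Fin n) ℝ) :
    IsHurwitz (Bmat A) ↔ IsUnit A := by
  rw [← isUnit_map_ofReal]
  simp only [IsHurwitz, Bmat_map, Matrix.mem_spectrum_iff_exists_mulVec_eq_smul]
  constructor
  · intro h
    by_contra hA
    rw [Matrix.isUnit_iff_isUnit_det, isUnit_iff_ne_zero, not_not,
      ← Matrix.exists_mulVec_eq_zero_iff] at hA
    obtain ⟨x, hx0, hx⟩ := hA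
    refine lt_irrefl _ (h 0 ⟨Sum.elim x 0, fun h0 => hx0 ?_, ?_⟩)
    · ext i
      simpa using congrFun h0 (Sum.inl i)
    · simp [fromBlocks_mulVec, hx, neg_mulVec]
  · rintro hA c ⟨v, hv0, hv⟩
    obtain ⟨x, y, rfl⟩ : ∃ x y, v = Sum.elim x y :=
      ⟨v ∘ Sum.inl, v ∘ Sum.inr, (Sum.elim_comp_inl_inr v).symm⟩
    have hx : (A.map Complex.ofReal)ᵀ *ᵥ y = c • x := by
      ext i
      simpa [fromBlocks_mulVec] using congrFun hv (Sum.inl i)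
    have hy : -(A.map Complex.ofReal *ᵥ x) - y = c • y := by
      ext i
      simpa [fromBlocks_mulVec, neg_mulVec, sub_eq_add_neg] using congrFun hv (Sum.inr i)
    have hE := re_mul_eq_neg_of_eigenvector A hx hy
    have hx_nonneg := star_dotProduct_self_re_nonneg x
    have hy_nonneg := star_dotProduct_self_re_nonneg y
    by_contra! hc
    have hyy : (star y ⬝ᵥ y).re = 0 := by
      have := mul_nonneg hc (add_nonneg hx_nonneg hy_nonneg)
      linarith
    have hy0 : y = 0 :=
      dotProduct_star_self_eq_zero.1 (Complex.ext hyy (star_dotProduct_self_im y))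
    subst hy0
    have hx0 : x = 0 :=
      Matrix.mulVec_injective_of_isUnit hA (by simpa using hy)
    exact hv0 (by simp [hx0])

/-- Every convex combination `∑ pᵢ Aᵢ` is invertible iff every convex combination
`∑ pᵢ B(Aᵢ)` is Hurwitz stable. -/
theorem polytope_nonsingular_iff_Bmat_polytope_hurwitz (n k : ℕ) (hn : 1 ≤ n) (hk : 1 ≤ k)
    (A : Fin k → Matrix (Fin n) (Fin n) ℝ) :
    (∀ p ∈ stdSimplex ℝ (Fin k), IsUnit (∑ i, p i • A i)) ↔
      (∀ p ∈ stdSimplex ℝ (Fin k), IsHurwitz (∑ i, p i • Bmat (A i))) := by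
  refine forall₂_congr fun p hp => ?_
  rw [sum_smul_Bmat A hp.2, isHurwitz_Bmat_iff]
end

section
/- Let n, k ≥ 1 and let A₁, …, A_k be real n×n matrices. Suppose there exist a measurable function C : [0,1] → ℝ^{2n×2n} with C(τ) in the convex hull of {B(A₁), …, B(A_k)} for every τ ∈ [0,1], and a continuous function x : [0,1] → ℝ^{2n} satisfying x(t) = x(0) + ∫₀ᵗ C(τ)x(τ) dτ and ‖x(t)‖₂ = 1 for all t ∈ [0,1]. Then there exists p ∈ S_k such that Σ_{i=1}^k p_i A_i is singular. -/
open Matrix MeasureTheory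

/-- The Euclidean norm on `ι → ℝ`. -/
noncomputable def euclNorm {ι : Type*} [Fintype ι] (x : ι → ℝ) : ℝ :=
  Real.sqrt (∑ i, x i ^ 2)

theorem exists_stdSimplex_eq_of_mem_convexHull_Bmat {n k : ℕ}
    (A : Fin k → Matrix (Fin n) (Fin n) ℝ) {M : Matrix (Fin n ⊕ Fin n) (Fin n ⊕ Fin n) ℝ}
    (hM : M ∈ convexHull ℝ (Set.range fun i => Bmat (A i))) :
    ∃ p ∈ stdSimplex ℝ (Fin k), M = Bmat (∑ i, p i • A i) := by
  have hconv : Convex ℝ {N | ∃ p ∈ stdSimplex ℝ (Fin k), N = Bmat (∑ i, p i • A i)} := by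
    rintro _ ⟨p, hp, rfl⟩ _ ⟨q, hq, rfl⟩ a b ha hb hab
    refine ⟨a • p + b • q, convex_stdSimplex ℝ _ hp hq ha hb hab, ?_⟩
    have h : ∑ i, (a • p + b • q) i • A i = a • ∑ i, p i • A i + b • ∑ i, q i • A i := by
      simp [Finset.smul_sum, Finset.sum_add_distrib, add_smul, mul_smul]
    rw [h]
    simp only [Bmat, fromBlocks_smul, fromBlocks_add, transpose_add, transpose_smul]
    congr 1
    · simp
    · simp [add_comm]
    · simp [← add_smul, ← neg_add, hab]
  refine convexHull_min ?_ hconv hM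
  rintro _ ⟨i, rfl⟩
  refine ⟨Pi.single i 1, single_mem_stdSimplex ℝ i, ?_⟩
  simp [Pi.single_apply]

theorem exists_abs_entry_le_of_mem_convexHull_range {ι m : Type*} [Finite ι]
    (B : ι → Matrix m m ℝ) (i j : m) :
    ∃ K : ℝ, ∀ M ∈ convexHull ℝ (Set.range B), ‖M i j‖ ≤ K := by
  have hfin : ((Matrix.entryLinearMap ℝ ℝ i j) '' Set.range B).Finite :=
    (Set.finite_range B).image _
  obtain ⟨K, hK⟩ := (isBounded_convexHull.2 hfin.isBounded).exists_norm_le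
  refine ⟨K, fun M hM => hK _ ?_⟩
  rw [← LinearMap.image_convexHull]
  exact ⟨M, hM, rfl⟩

theorem dotProduct_Bmat_mulVec {n : ℕ} (A : Matrix (Fin n) (Fin n) ℝ) (y : Fin n ⊕ Fin n → ℝ) :
    y ⬝ᵥ Bmat A *ᵥ y = -∑ i, y (Sum.inr i) ^ 2 := by
  obtain ⟨u, v, rfl⟩ : ∃ u v, y = Sum.elim u v :=
    ⟨y ∘ Sum.inl, y ∘ Sum.inr, (Sum.elim_comp_inl_inr y).symm⟩
  have h : u ⬝ᵥ Aᵀ *ᵥ v = v ⬝ᵥ A *ᵥ u := by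
    rw [mulVec_transpose, dotProduct_comm, ← dotProduct_mulVec]
  simp only [Bmat, fromBlocks_mulVec, Sum.elim_comp_inl, Sum.elim_comp_inr,
    sumElim_dotProduct_sumElim, zero_mulVec, zero_add,
    neg_mulVec, one_mulVec, dotProduct_add, dotProduct_neg, h, Sum.elim_inr]
  simp [dotProduct, sq]

theorem integrableOn_mulVec {m : Type*} [Fintype m] {s : Set ℝ} (hs : IsCompact s)
    {C : ℝ → Matrix m m ℝ} {x : ℝ → m → ℝ} (hC_meas : ∀ i j, Measurable fun τ => C τ i j)
    (hC_bdd : ∀ i j, ∃ K : ℝ, ∀ τ ∈ s, ‖C τ i j‖ ≤ K) (hx : ContinuousOn x s) :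
    IntegrableOn (fun τ => C τ *ᵥ x τ) s := by
  refine Integrable.of_eval fun i => ?_
  refine integrable_finsetSum _ fun j _ => ?_
  obtain ⟨K, hK⟩ := hC_bdd i j
  have hC : IntegrableOn (fun τ => C τ i j) s :=
    IntegrableOn.of_bound hs.measure_lt_top (hC_meas i j).aestronglyMeasurable K
      (ae_restrict_of_forall_mem hs.measurableSet hK)
  exact hC.mul_continuousOn ((continuous_apply j).comp_continuousOn hx) hs

theorem euclNorm_sq {ι : Type*} [Fintype ι] (x : ι → ℝ) : euclNorm x ^ 2 = ∑ i, x i ^ 2 :=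
  Real.sq_sqrt (Finset.sum_nonneg fun i _ => sq_nonneg (x i))

theorem dotProduct_eq_zero_of_hasDerivAt {ι : Type*} [Fintype ι]
    {x : ℝ → ι → ℝ} {y : ι → ℝ} {t c : ℝ}
    (hx : HasDerivAt x y t) (hc : ∀ᶠ s in nhds t, euclNorm (x s) = c) : x t ⬝ᵥ y = 0 := by
  have h1 : HasDerivAt (fun s => ∑ i, x s i ^ 2) (∑ i, 2 * x t i * y i) t := by
    refine HasDerivAt.fun_sum fun i _ => ?_
    simpa using (hasDerivAt_pi.1 hx i).fun_pow 2
  have h2 : HasDerivAt (fun s => ∑ i, x s i ^ 2) 0 t :=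
    (hasDerivAt_const t (c ^ 2)).congr_of_eventuallyEq <| by
      filter_upwards [hc] with s hs
      rw [← euclNorm_sq, hs]
  have h3 := h1.unique h2
  simp only [mul_assoc, ← Finset.mul_sum] at h3
  simpa [dotProduct] using h3

theorem det_eq_zero_of_Bmat_mulVec_inr_eq_zero {n : ℕ} {A : Matrix (Fin n) (Fin n) ℝ}
    {y : Fin n ⊕ Fin n → ℝ} (hy : y ≠ 0) (hv : ∀ i, y (Sum.inr i) = 0)
    (hBy : ∀ i, (Bmat A *ᵥ y) (Sum.inr i) = 0) : A.det = 0 := by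
  refine exists_mulVec_eq_zero_iff.1 ⟨y ∘ Sum.inl, fun hu => hy ?_, ?_⟩
  · ext (i | i)
    · exact congrFun hu i
    · exact hv i
  · have h0 : y ∘ Sum.inr = 0 := funext hv
    ext i
    simpa [Bmat, fromBlocks_mulVec, h0, neg_mulVec] using hBy i

/-- If there is a continuous unit-norm solution `x : [0,1] → ℝ^{2n}` of
`x(t) = x(0) + ∫₀ᵗ C(τ)x(τ) dτ` with measurable `C(τ)` valued in the convex hull of
`{B(A₁), …, B(A_k)}`, then some convex combination `∑ pᵢ Aᵢ` is singular. -/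
theorem exists_singular_combination_of_unit_norm_solution (n k : ℕ) (hn : 1 ≤ n)
    (hk : 1 ≤ k) (A : Fin k → Matrix (Fin n) (Fin n) ℝ)
    (C : ℝ → Matrix (Fin n ⊕ Fin n) (Fin n ⊕ Fin n) ℝ)
    (hC_meas : ∀ i j, Measurable fun τ => C τ i j)
    (hC_mem : ∀ τ ∈ Set.Icc (0 : ℝ) 1,
      C τ ∈ convexHull ℝ (Set.range fun i => Bmat (A i)))
    (x : ℝ → (Fin n ⊕ Fin n → ℝ))
    (hx_cont : ContinuousOn x (Set.Icc (0 : ℝ) 1))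
    (hx_eq : ∀ t ∈ Set.Icc (0 : ℝ) 1,
      x t = x 0 + ∫ τ in (0 : ℝ)..t, (C τ).mulVec (x τ))
    (hx_norm : ∀ t ∈ Set.Icc (0 : ℝ) 1, euclNorm (x t) = 1) :
    ∃ p ∈ stdSimplex ℝ (Fin k), (∑ i, p i • A i).det = 0 := by
  choose! p hp hCp using fun τ hτ => exists_stdSimplex_eq_of_mem_convexHull_Bmat A (hC_mem τ hτ)
  have hint : IntervalIntegrable (fun τ => C τ *ᵥ x τ) volume 0 1 := by
    rw [intervalIntegrable_iff_integrableOn_Icc_of_le zero_le_one]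
    refine integrableOn_mulVec isCompact_Icc hC_meas (fun i j => ?_) hx_cont
    obtain ⟨K, hK⟩ := exists_abs_entry_le_of_mem_convexHull_range (fun i => Bmat (A i)) i j
    exact ⟨K, fun τ hτ => hK _ (hC_mem τ hτ)⟩
  have hderiv : ∀ᵐ t, t ∈ Set.Ioo (0 : ℝ) 1 → HasDerivAt x (C t *ᵥ x t) t := by
    filter_upwards [hint.ae_hasDerivAt_integral] with t ht htI
    rw [Set.uIcc_of_le zero_le_one] at ht
    refine ((ht (Set.Ioo_subset_Icc_self htI) 0 (by simp)).const_add (x 0)).congr_of_eventuallyEq ?_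
    filter_upwards [Icc_mem_nhds htI.1 htI.2] with s hs using hx_eq s hs
  have hv_ae : ∀ᵐ t, t ∈ Set.Ioo (0 : ℝ) 1 → ∀ i, x t (Sum.inr i) = 0 := by
    filter_upwards [hderiv] with t ht htI
    have h := dotProduct_eq_zero_of_hasDerivAt (ht htI)
      (Filter.mem_of_superset (Icc_mem_nhds htI.1 htI.2) hx_norm)
    rw [hCp t (Set.Ioo_subset_Icc_self htI), dotProduct_Bmat_mulVec, neg_eq_zero,
      Finset.sum_eq_zero_iff_of_nonneg fun i _ => sq_nonneg _] at h
    exact fun i => pow_eq_zero_iff two_ne_zero |>.1 (h i (Finset.mem_univ i))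
  have hv : ∀ i, Set.EqOn (fun t => x t (Sum.inr i)) (fun _ => 0) (Set.Ioo 0 1) := fun i => by
    refine Measure.eqOn_Ioo_of_ae_eq (μ := volume) ?_ ?_ continuousOn_const
    · rw [Filter.EventuallyEq, ae_restrict_iff' measurableSet_Ioo]
      filter_upwards [hv_ae] with t ht htI using ht htI i
    · exact ((continuous_apply _).comp_continuousOn hx_cont).mono Set.Ioo_subset_Icc_self
  obtain ⟨t, ht, htI⟩ : ∃ t, HasDerivAt x (C t *ᵥ x t) t ∧ t ∈ Set.Ioo (0 : ℝ) 1 := by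
    obtain ⟨t, htI, ht⟩ := (Measure.dense_of_ae hderiv).inter_open_nonempty _ isOpen_Ioo
      (Set.nonempty_Ioo.2 zero_lt_one)
    exact ⟨t, ht htI, htI⟩
  have htI' := Set.Ioo_subset_Icc_self htI
  refine ⟨p t, hp t htI', det_eq_zero_of_Bmat_mulVec_inr_eq_zero (y := x t) ?_
    (fun i => hv i htI) fun i => ?_⟩
  · intro h0
    simpa [h0, euclNorm] using hx_norm t htI'
  · rw [← hCp t htI']
    refine (hasDerivAt_pi.1 ht (Sum.inr i)).unique ?_
    exact (hasDerivAt_const t 0).congr_of_eventuallyEq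
      ((hv i).eventuallyEq_of_mem (Ioo_mem_nhds htI.1 htI.2))
end
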